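/- Fix r ≥ 4 and an odd prime power q, and let H_{r,q} be the hypergraph on A ∪ B whose edges are e(ℓ) = (ℓ ∩ A) ∪ {p(ℓ)} over non-horizontal affine lines ℓ meeting B (for a fixed choice function p). Let T ⊆ [r]×[r] with |T| = t ≤ r − 3. Then there do not exist affine lines ℓ₁, …, ℓ_r and m₁, …, m_r supporting edges R_i = e(ℓ_i) and C_j = e(m_j) of H_{r,q} such that: (i) the 2r edges R_1, …, R_r, C_1, …, C_r form a copy of the punctured intersection P_r(T) (i.e., R_i ∩ C_j = ∅ for (i,j) ∈ T, |R_i ∩ C_j| = 1 for (i,j) ∉ T, with the r² − t intersection vertices pairwise distinct); (ii) the r² projective intersection points of the closures of ℓ_i and m_j are pairwise distinct in the projective plane over F_q (transversality); and (iii) for every (i,j) ∈ T, the intersection point of ℓ_i and m_j is an affine point not belonging to A ∪ B. -/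

import Mathlib

open Polynomial in
/-- The bivariate polynomial `∏ i, (x + b i * y - c i)`, monic in the outer variable `x`. -/
noncomputable def lineProduct {F ι : Type*} [Field F] [Fintype ι] (b c : ι → F) : F[X][X] :=
  ∏ i, (X + C (C (b i) * X - C (c i)))

/-- `N` has total degree at most `n`. -/
def TotalDegreeLE {F : Type*} [Field F] (n : ℕ) (N : Polynomial (Polynomial F)) : Prop :=
  ∀ k l, n < k + l → (N.coeff k).coeff l = 0

namespace TotalDegreeLE

open Polynomial

variable {F : Type*} [Field F]

lemma mul {m n : ℕ} {P Q : F[X][X]} (hP : TotalDegreeLE m P) (hQ : TotalDegreeLE n Q) :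
    TotalDegreeLE (m + n) (P * Q) := by
  intro k l hkl
  rw [coeff_mul, finsetSum_coeff]
  refine Finset.sum_eq_zero fun x hx => ?_
  rw [coeff_mul]
  refine Finset.sum_eq_zero fun y hy => ?_
  rw [Finset.HasAntidiagonal.mem_antidiagonal] at hx hy
  rcases lt_or_ge m (x.1 + y.1) with h | h
  · rw [hP _ _ h, zero_mul]
  · rw [hQ x.2 y.2 (by omega), mul_zero]

lemma one : TotalDegreeLE 0 (1 : F[X][X]) := by
  intro k l hkl
  rw [coeff_one]
  split_ifs with h
  · rw [coeff_one, if_neg (by omega)]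
  · simp

lemma sub {n : ℕ} {P Q : F[X][X]} (hP : TotalDegreeLE n P) (hQ : TotalDegreeLE n Q) :
    TotalDegreeLE n (P - Q) := by
  intro k l hkl
  rw [coeff_sub, coeff_sub, hP k l hkl, hQ k l hkl, sub_zero]

lemma line (b c : F) : TotalDegreeLE 1 (X + C (C b * X - C c) : F[X][X]) := by
  intro k l hkl
  rcases k with _ | _ | k
  · obtain ⟨l, rfl⟩ : ∃ m, l = m + 2 := ⟨l - 2, by omega⟩
    simp [coeff_X, coeff_C]
  · obtain ⟨l, rfl⟩ : ∃ m, l = m + 1 := ⟨l - 1, by omega⟩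
    simp [coeff_X, coeff_one]
  · simp [coeff_X]

lemma lineProduct {ι : Type*} [Fintype ι] (b c : ι → F) :
    TotalDegreeLE (Fintype.card ι) (lineProduct b c) := by
  classical
  have key : ∀ s : Finset ι,
      TotalDegreeLE s.card (∏ i ∈ s, (X + C (C (b i) * X - C (c i))) : F[X][X]) := by
    intro s
    induction s using Finset.induction_on with
    | empty => simpa using one
    | insert i s hi ih =>
      rw [Finset.prod_insert hi, Finset.card_insert_of_notMem hi, add_comm]
      exact (line _ _).mul ih
  exact key Finset.univ

lemma of_C_mul {n : ℕ} {a : F} {N : F[X][X]}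
    (h : TotalDegreeLE (n + 1) (C (X - C a) * N)) : TotalDegreeLE n N := by
  intro k l hkl
  by_contra hne
  have h0 : N.coeff k ≠ 0 := fun h0 => hne (by simp [h0])
  have hl : l ≤ (N.coeff k).natDegree := le_natDegree_of_ne_zero hne
  have hlead := h k ((N.coeff k).natDegree + 1) (by omega)
  have hdeg : ((X - C a) * N.coeff k).natDegree = (N.coeff k).natDegree + 1 := by
    rw [natDegree_mul (X_sub_C_ne_zero a) h0, natDegree_X_sub_C, add_comm]
  rw [coeff_C_mul, ← hdeg, coeff_natDegree, leadingCoeff_eq_zero] at hlead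
  exact mul_ne_zero (X_sub_C_ne_zero a) h0 hlead

end TotalDegreeLE

section

open Polynomial

variable {F : Type*} [Field F]

lemma eval_lineProduct_eq_zero {ι : Type*} [Fintype ι] (b c : ι → F) {x y : F}
    (h : ∃ i, x + b i * y = c i) :
    ((lineProduct b c).map (evalRingHom y)).eval x = 0 := by
  obtain ⟨i, hi⟩ := h
  rw [lineProduct, Polynomial.map_prod, eval_prod]
  refine Finset.prod_eq_zero (Finset.mem_univ i) ?_
  simp [← hi]

lemma coeff_lineProduct_sub_lineProduct {ι : Type*} [Fintype ι] (b c b' c' : ι → F) {k : ℕ}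
    (hk : Fintype.card ι ≤ k) : (lineProduct b c - lineProduct b' c').coeff k = 0 := by
  have key : ∀ b c : ι → F, (lineProduct b c).coeff (Fintype.card ι) = 1 := by
    intro b c
    have hm : ∀ i ∈ Finset.univ, (X + C (C (b i) * X - C (c i)) : F[X][X]).Monic :=
      fun i _ => monic_X_add_C _
    have hd : (lineProduct b c).natDegree = Fintype.card ι := by
      rw [lineProduct, natDegree_prod_of_monic _ _ hm]
      simp only [natDegree_X_add_C, Finset.sum_const, smul_eq_mul, mul_one, Finset.card_univ]
    rw [← hd]
    exact monic_prod_of_monic _ _ hm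
  rcases hk.eq_or_lt with rfl | hk
  · rw [coeff_sub, key, key, sub_self]
  · ext l
    exact ((TotalDegreeLE.lineProduct b c).sub (TotalDegreeLE.lineProduct b' c')) k l (by omega)

lemma exists_eq_of_lineProduct_eq {ι : Type*} [Fintype ι] {b c b' c' : ι → F}
    (h : lineProduct b c = lineProduct b' c') (i : ι) : ∃ j, b i = b' j ∧ c i = c' j := by
  have h0 : (lineProduct b c).eval (C (c i) - C (b i) * X) = 0 := by
    rw [lineProduct, eval_prod]
    refine Finset.prod_eq_zero (Finset.mem_univ i) ?_
    simp
  rw [h, lineProduct, eval_prod, Finset.prod_eq_zero_iff] at h0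
  obtain ⟨j, -, hj⟩ := h0
  refine ⟨j, ?_, ?_⟩
  · have := congrArg (fun p => coeff p 1) hj
    simp [coeff_C] at this
    linear_combination -this
  · have := congrArg (fun p => coeff p 0) hj
    simp at this
    linear_combination this

lemma C_dvd_of_eval_eq_zero (N : F[X][X]) (a : F) (P : Finset F)
    (hN : ∀ k, P.card ≤ k → N.coeff k = 0)
    (hv : ∀ x ∈ P, (N.map (evalRingHom a)).eval x = 0) : C (X - C a) ∣ N := by
  have hz : N.map (evalRingHom a) = 0 := by
    refine eq_zero_of_degree_lt_of_eval_finset_eq_zero P ?_ hv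
    rw [degree_lt_iff_coeff_zero]
    intro k hk
    rw [coeff_map, hN k hk, map_zero]
  rw [C_dvd_iff_dvd_coeff]
  intro k
  rw [dvd_iff_isRoot]
  have := congrArg (fun p => coeff p k) hz
  simpa using this

lemma eq_zero_of_eval_parabola {g : F[X][X]} (hg : TotalDegreeLE 1 g) (P : Finset F)
    (hP : 3 ≤ P.card) (hv : ∀ x ∈ P, (g.map (evalRingHom (x ^ 2))).eval x = 0) : g = 0 := by
  have hform : g = C (C ((g.coeff 0).coeff 0) + C ((g.coeff 0).coeff 1) * X) +
      C (C ((g.coeff 1).coeff 0)) * X := by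
    ext k l
    rcases k with _ | _ | k
    · rcases l with _ | _ | l
      · simp
      · simp [coeff_C]
      · simp [coeff_C, coeff_X, hg 0 (l + 2) (by omega)]
    · rcases l with _ | l
      · simp [coeff_C]
      · simp [coeff_C, hg 1 (l + 1) (by omega)]
    · simp [hg (k + 2) l (by omega)]
  generalize (g.coeff 0).coeff 0 = u at hform
  generalize (g.coeff 0).coeff 1 = v at hform
  generalize (g.coeff 1).coeff 0 = w at hform
  have hq : C v * X ^ 2 + C w * X + C u = (0 : F[X]) := by
    refine eq_zero_of_degree_lt_of_eval_finset_eq_zero P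
      (degree_quadratic_le.trans_lt (by exact_mod_cast hP)) fun x hx => ?_
    have := hv x hx
    rw [hform] at this
    simp at this
    simp
    linear_combination this
  have h0 := congrArg (fun p => coeff p 0) hq
  have h1 := congrArg (fun p => coeff p 1) hq
  have h2 := congrArg (fun p => coeff p 2) hq
  simp [coeff_C, coeff_X] at h0 h1 h2
  rw [hform, h0, h1, h2]
  simp

/-- Two products of `r` lines agreeing on more than `r² - r + 2` points of the union of `r - 1`
horizontal lines and the parabola, at most `r` of them on the parabola, are equal. -/
lemma lineProduct_eq_of_card {r : ℕ} (hr : 4 ≤ r) (b c b' c' : Fin r → F)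
    (α : Fin (r - 1) → F) (hα : Function.Injective α) (hns : ∀ s x, x ^ 2 ≠ α s)
    (Z : Finset (F × F)) (hcard : r * r + 3 ≤ Z.card + r)
    (hL : ∀ z ∈ Z, ∃ i, z.1 + b i * z.2 = c i) (hM : ∀ z ∈ Z, ∃ j, z.1 + b' j * z.2 = c' j)
    (ZB : Finset (F × F)) (hZB : ZB.card ≤ r) (hsub : ZB ⊆ Z) (hpar : ∀ z ∈ ZB, z.2 = z.1 ^ 2)
    (hcov : ∀ z ∈ Z, (∃ s, z.2 = α s) ∨ z ∈ ZB) :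
    lineProduct b c = lineProduct b' c' := by
  classical
  set G : F[X][X] := lineProduct b c - lineProduct b' c' with hG
  have hGz : ∀ z ∈ Z, (G.map (evalRingHom z.2)).eval z.1 = 0 := by
    intro z hz
    rw [hG, Polynomial.map_sub, eval_sub, eval_lineProduct_eq_zero _ _ (hL z hz),
      eval_lineProduct_eq_zero _ _ (hM z hz), sub_zero]
  let P : Fin (r - 1) → Finset F := fun s => (Z.filter fun z => z.2 = α s).image Prod.fst
  have hPmem : ∀ s x, x ∈ P s → (x, α s) ∈ Z := by
    intro s x hx
    simp only [P, Finset.mem_image, Finset.mem_filter] at hx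
    obtain ⟨z, ⟨hz, hzs⟩, rfl⟩ := hx
    rwa [← hzs]
  have hPle : ∀ s, (P s).card ≤ r := by
    intro s
    have : P s ⊆ Finset.univ.image fun i => c i - b i * α s := by
      intro x hx
      obtain ⟨i, hi⟩ := hL _ (hPmem s x hx)
      exact Finset.mem_image.2 ⟨i, Finset.mem_univ i, by rw [← hi]; ring⟩
    simpa using (Finset.card_le_card this).trans Finset.card_image_le
  have hsum : Z.card ≤ ∑ s, (P s).card + ZB.card := by
    have hZ : Z ⊆ (Finset.univ.biUnion fun s => (P s).image fun x => (x, α s)) ∪ ZB := by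
      intro z hz
      rcases hcov z hz with ⟨s, hs⟩ | h
      · refine Finset.mem_union_left _ (Finset.mem_biUnion.2 ⟨s, Finset.mem_univ s, ?_⟩)
        refine Finset.mem_image.2 ⟨z.1, ?_, by rw [← hs]⟩
        exact Finset.mem_image.2 ⟨z, Finset.mem_filter.2 ⟨hz, hs⟩, rfl⟩
      · exact Finset.mem_union_right _ h
    refine (Finset.card_le_card hZ).trans ((Finset.card_union_le _ _).trans ?_)
    gcongr
    exact Finset.card_biUnion_le.trans (Finset.sum_le_sum fun s _ => Finset.card_image_le)
  have hsplit : ∀ (S : Finset (Fin (r - 1))) (d : ℕ), (∀ s ∉ S, (P s).card ≤ d) →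
      Z.card ≤ S.card * r + (r - 1 - S.card) * d + r := by
    intro S d hd
    have h1 : ∑ s ∈ S, (P s).card ≤ S.card * r := by
      simpa using Finset.sum_le_card_nsmul S _ r fun s _ => hPle s
    have h2 : ∑ s ∈ Sᶜ, (P s).card ≤ (r - 1 - S.card) * d := by
      simpa [Finset.card_compl] using Finset.sum_le_card_nsmul Sᶜ (fun s => (P s).card) d
        fun s hs => hd s (Finset.mem_compl.1 hs)
    have h3 := Finset.sum_add_sum_compl S fun s => (P s).card
    omega
  have hind : ∀ n ≤ r - 1, ∃ S : Finset (Fin (r - 1)), S.card = n ∧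
      ∃ N : F[X][X], G = C (∏ s ∈ S, (X - C (α s))) * N ∧ (∀ k, r ≤ k → N.coeff k = 0) ∧
        TotalDegreeLE (r - n) N := by
    intro n
    induction n with
    | zero =>
      intro _
      refine ⟨∅, rfl, G, by simp, fun k hk => ?_, ?_⟩
      · exact coeff_lineProduct_sub_lineProduct _ _ _ _ (by simpa using hk)
      · simpa using (TotalDegreeLE.lineProduct b c).sub (TotalDegreeLE.lineProduct b' c')
    | succ n ih =>
      intro hn
      obtain ⟨S, hS, N, hN, hNr, hNd⟩ := ih (by omega)
      obtain ⟨s, hs, hsc⟩ : ∃ s ∉ S, ∀ k, (P s).card ≤ k → r ≤ k ∨ r - n < k := by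
        rcases Nat.eq_zero_or_pos n with rfl | hn0
        · by_contra! hcon
          have := hsplit S (r - 1) fun s hs => by
            obtain ⟨k, hk, hk', -⟩ := hcon s hs
            omega
          obtain ⟨m, rfl⟩ : ∃ m, r = m + 1 := ⟨r - 1, by omega⟩
          simp only [hS, Nat.add_sub_cancel, Nat.sub_zero, zero_mul] at this
          nlinarith
        · by_contra! hcon
          have := hsplit S (r - n) fun s hs => by
            obtain ⟨k, hk, -, hk'⟩ := hcon s hs
            omega
          obtain ⟨m, rfl⟩ : ∃ m, r = n + 2 + m := ⟨r - n - 2, by omega⟩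
          obtain ⟨n, rfl⟩ : ∃ l, n = l + 1 := ⟨n - 1, by omega⟩
          rw [hS, show n + 1 + 2 + m - 1 - (n + 1) = m + 1 by omega,
            show n + 1 + 2 + m - (n + 1) = m + 2 by omega] at this
          nlinarith [Nat.zero_le (n * m)]
      have hdvd : C (X - C (α s)) ∣ N := by
        refine C_dvd_of_eval_eq_zero N (α s) (P s) (fun k hk => ?_) fun x hx => ?_
        · rcases hsc k hk with h | h
          · exact hNr k h
          · ext l
            exact hNd k l (by omega)
        · have h0 := hGz _ (hPmem s x hx)
          rw [hN, Polynomial.map_mul, eval_mul, map_C, eval_C, coe_evalRingHom, eval_prod,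
            mul_eq_zero, Finset.prod_eq_zero_iff] at h0
          refine h0.resolve_left ?_
          rintro ⟨s', hs', h⟩
          simp only [eval_sub, eval_X, eval_C] at h
          exact hs (hα (sub_eq_zero.1 h) ▸ hs')
      obtain ⟨N', rfl⟩ := hdvd
      refine ⟨insert s S, by rw [Finset.card_insert_of_notMem hs, hS], N', ?_, ?_, ?_⟩
      · rw [hN, Finset.prod_insert hs, C_mul]
        ring
      · intro k hk
        have := hNr k hk
        rw [coeff_C_mul] at this
        exact (mul_eq_zero.1 this).resolve_left (X_sub_C_ne_zero _)
      · refine TotalDegreeLE.of_C_mul (a := α s) ?_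
        rwa [show r - (n + 1) + 1 = r - n by omega]
  obtain ⟨S, -, g, hg, -, hgd⟩ := hind (r - 1) le_rfl
  rw [show r - (r - 1) = 1 by omega] at hgd
  have hB3 : 3 ≤ (ZB.image Prod.fst).card := by
    rw [Finset.card_image_of_injOn]
    · have h1 : ∑ s, (P s).card ≤ (r - 1) * r := by
        simpa using Finset.sum_le_card_nsmul Finset.univ (fun s => (P s).card) r fun s _ => hPle s
      obtain ⟨m, rfl⟩ : ∃ m, r = m + 1 := ⟨r - 1, by omega⟩
      simp only [Nat.add_sub_cancel] at h1
      nlinarith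
    · intro z hz z' hz' h
      exact Prod.ext h (by rw [hpar z hz, hpar z' hz', h])
  have hg0 : g = 0 := by
    refine eq_zero_of_eval_parabola hgd _ hB3 fun x hx => ?_
    obtain ⟨z, hz, rfl⟩ := Finset.mem_image.1 hx
    have h0 := hGz z (hsub hz)
    rw [hg, Polynomial.map_mul, eval_mul, map_C, eval_C, coe_evalRingHom, eval_prod,
      mul_eq_zero, Finset.prod_eq_zero_iff, hpar z hz] at h0
    refine h0.resolve_left ?_
    rintro ⟨s, -, h⟩
    simp only [eval_sub, eval_X, eval_C] at h
    exact hns s _ (sub_eq_zero.1 h)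
  exact sub_eq_zero.1 (by rw [← hG, hg, hg0, mul_zero])

end

/-- In the hypergraph `H_{r,q}` (edges `e(ℓ) = (ℓ ∩ A) ∪ {p(ℓ)}` over
non-horizontal affine lines `ℓ` meeting the parabola `B`), for `r ≥ 4` and `|T| = t ≤ r − 3`
there is no transverse copy of the punctured intersection `P_r(T)` whose missing
row–column intersection points are affine points outside `A ∪ B`. -/
theorem stmt10 (F : Type*) [Field F] [Fintype F] (hodd : Odd (Fintype.card F))
    (r : ℕ) (hr : 4 ≤ r)
    (α : Fin (r - 1) → F) (hαinj : Function.Injective α)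
    (hαns : ∀ s, α s ≠ 0 ∧ ¬ ∃ x : F, x ^ 2 = α s)
    (A B : Set (F × F))
    (hA : A = ⋃ s : Fin (r - 1), {pt : F × F | pt.2 = α s})
    (hB : B = {pt : F × F | pt.2 = pt.1 ^ 2})
    (p : Set (F × F) → F × F)
    (hp : ∀ ℓ : Set (F × F),
      (∃ a b c : F, a ≠ 0 ∧ ℓ = {pt : F × F | a * pt.1 + b * pt.2 = c}) →
      (ℓ ∩ B).Nonempty → p ℓ ∈ ℓ ∩ B)
    (t : ℕ) (ht : t ≤ r - 3) (T : Finset (Fin r × Fin r)) (hT : T.card = t) :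
    ¬ ∃ (la lb lc ma mb mc : Fin r → F)
        (R C : Fin r → Set (F × F)) (v : Fin r → Fin r → F × F)
        (w : Fin r → Fin r → Fin 3 → F),
      -- the supporting lines are non-horizontal and meet B (so the R_i, C_j are edges of H)
      (∀ i, la i ≠ 0) ∧ (∀ j, ma j ≠ 0) ∧
      (∀ i, ({pt : F × F | la i * pt.1 + lb i * pt.2 = lc i} ∩ B).Nonempty) ∧
      (∀ j, ({pt : F × F | ma j * pt.1 + mb j * pt.2 = mc j} ∩ B).Nonempty) ∧
      (∀ i, R i = ({pt : F × F | la i * pt.1 + lb i * pt.2 = lc i} ∩ A) ∪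
        {p {pt : F × F | la i * pt.1 + lb i * pt.2 = lc i}}) ∧
      (∀ j, C j = ({pt : F × F | ma j * pt.1 + mb j * pt.2 = mc j} ∩ A) ∪
        {p {pt : F × F | ma j * pt.1 + mb j * pt.2 = mc j}}) ∧
      -- (i) the 2r edges form a copy of the punctured intersection P_r(T)
      Function.Injective (Sum.elim R C) ∧
      (∀ i j, (i, j) ∈ T → R i ∩ C j = ∅) ∧
      (∀ i j, (i, j) ∉ T → R i ∩ C j = {v i j}) ∧
      (∀ i j i' j', (i, j) ∉ T → (i', j') ∉ T → (i, j) ≠ (i', j') → v i j ≠ v i' j') ∧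
      -- (ii) transversality: w i j represents the unique projective intersection point of
      -- the closures of ℓ_i and m_j, and these r² points are pairwise distinct
      (∀ i j, w i j ≠ 0) ∧
      (∀ i j, la i * w i j 0 + lb i * w i j 1 - lc i * w i j 2 = 0) ∧
      (∀ i j, ma j * w i j 0 + mb j * w i j 1 - mc j * w i j 2 = 0) ∧
      (∀ i j (u : Fin 3 → F), u ≠ 0 →
        la i * u 0 + lb i * u 1 - lc i * u 2 = 0 →
        ma j * u 0 + mb j * u 1 - mc j * u 2 = 0 → ∃ c : F, u = c • w i j) ∧
      (∀ i j i' j', (i, j) ≠ (i', j') → ¬ ∃ c : F, w i' j' = c • w i j) ∧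
      -- (iii) for (i,j) ∈ T the intersection point is affine and lies outside A ∪ B
      (∀ i j, (i, j) ∈ T → w i j 2 ≠ 0 ∧
        ((w i j 0 / w i j 2, w i j 1 / w i j 2) : F × F) ∉ A ∪ B) := by
  classical
  rintro ⟨la, lb, lc, ma, mb, mc, R, C, v, w, hla, hma, hlB, hmB, hR, hC, hinj, -, hv, hvinj, -⟩
  have hmem : ∀ i j, (i, j) ∉ T → v i j ∈ R i ∧ v i j ∈ C j := by
    intro i j hij
    have : v i j ∈ R i ∩ C j := by rw [hv i j hij]; rfl
    exact this
  have hpl : ∀ i, p {pt : F × F | la i * pt.1 + lb i * pt.2 = lc i} ∈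
      {pt : F × F | la i * pt.1 + lb i * pt.2 = lc i} ∩ B :=
    fun i => hp _ ⟨la i, lb i, lc i, hla i, rfl⟩ (hlB i)
  have hpm : ∀ j, p {pt : F × F | ma j * pt.1 + mb j * pt.2 = mc j} ∈
      {pt : F × F | ma j * pt.1 + mb j * pt.2 = mc j} ∩ B :=
    fun j => hp _ ⟨ma j, mb j, mc j, hma j, rfl⟩ (hmB j)
  have hnorm : ∀ {a : F} (b c : F) (z : F × F), a ≠ 0 →
      (a * z.1 + b * z.2 = c ↔ z.1 + b / a * z.2 = c / a) := by
    intro a b c z ha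
    rw [eq_div_iff ha, add_mul, mul_right_comm, div_mul_cancel₀ b ha, mul_comm z.1]
  have hRl : ∀ i, ∀ z ∈ R i, la i * z.1 + lb i * z.2 = lc i := by
    intro i z hz
    rw [hR] at hz
    rcases hz with hz | rfl
    exacts [hz.1, (hpl i).1]
  have hCm : ∀ j, ∀ z ∈ C j, ma j * z.1 + mb j * z.2 = mc j := by
    intro j z hz
    rw [hC] at hz
    rcases hz with hz | rfl
    exacts [hz.1, (hpm j).1]
  have hABdisj : ∀ z ∈ A, z ∉ B := by
    intro z hzA hzB
    rw [hA, Set.mem_iUnion] at hzA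
    obtain ⟨s, hs⟩ := hzA
    rw [hB] at hzB
    exact (hαns s).2 ⟨z.1, hzB.symm.trans hs⟩
  let Z : Finset (F × F) := Tᶜ.image fun ij => v ij.1 ij.2
  have hZ : ∀ z ∈ Z, ∃ i j, z ∈ R i ∧ z ∈ C j := by
    intro z hz
    obtain ⟨ij, hij, rfl⟩ := Finset.mem_image.1 hz
    exact ⟨ij.1, ij.2, hmem _ _ (Finset.mem_compl.1 hij)⟩
  have hZcard : Z.card = r * r - t := by
    rw [Finset.card_image_of_injOn, Finset.card_compl, hT]
    · simp
    · intro x hx y hy hxy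
      by_contra hne
      exact hvinj x.1 x.2 y.1 y.2 (by simpa using hx) (by simpa using hy) hne hxy
  have hLM := lineProduct_eq_of_card hr (fun i => lb i / la i) (fun i => lc i / la i)
    (fun j => mb j / ma j) (fun j => mc j / ma j) α hαinj
    (fun s x h => (hαns s).2 ⟨x, h⟩) Z (by rw [hZcard]; have := Nat.le_mul_self r; omega)
    (fun z hz => by
      obtain ⟨i, j, hi, -⟩ := hZ z hz
      exact ⟨i, (hnorm _ _ _ (hla i)).1 (hRl i z hi)⟩)
    (fun z hz => by
      obtain ⟨i, j, -, hj⟩ := hZ z hz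
      exact ⟨j, (hnorm _ _ _ (hma j)).1 (hCm j z hj)⟩)
    (Z.filter fun z => z ∈ B)
    (by
      have hsub : (Z.filter fun z => z ∈ B) ⊆
          Finset.univ.image fun i => p {pt : F × F | la i * pt.1 + lb i * pt.2 = lc i} := by
        intro z hz
        obtain ⟨hz, hzB⟩ := Finset.mem_filter.1 hz
        obtain ⟨i, j, hi, -⟩ := hZ z hz
        rw [hR] at hi
        rcases hi with hi | hi
        · exact absurd hzB (hABdisj z hi.2)
        · exact Finset.mem_image.2 ⟨i, Finset.mem_univ i, hi.symm⟩
      simpa using (Finset.card_le_card hsub).trans Finset.card_image_le)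
    (Finset.filter_subset _ _)
    (fun z hz => by
      have hzB := (Finset.mem_filter.1 hz).2
      rw [hB] at hzB
      exact hzB)
    (fun z hz => by
      obtain ⟨i, j, hi, -⟩ := hZ z hz
      rw [hR] at hi
      rcases hi with hi | rfl
      · have hzA := hi.2
        rw [hA, Set.mem_iUnion] at hzA
        exact Or.inl hzA
      · exact Or.inr (Finset.mem_filter.2 ⟨hz, (hpl i).2⟩))
  obtain ⟨j, hb, hc⟩ := exists_eq_of_lineProduct_eq hLM ⟨0, by omega⟩
  have hline : {pt : F × F | la ⟨0, by omega⟩ * pt.1 + lb ⟨0, by omega⟩ * pt.2 =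
      lc ⟨0, by omega⟩} = {pt : F × F | ma j * pt.1 + mb j * pt.2 = mc j} := by
    ext z
    rw [Set.mem_ofPred_eq, Set.mem_ofPred_eq, hnorm _ _ z (hla _), hnorm _ _ z (hma j), hb, hc]
  have hRC : R ⟨0, by omega⟩ = C j := by rw [hR, hC, hline]
  exact Sum.inl_ne_inr (hinj (a₁ := Sum.inl ⟨0, by omega⟩) (a₂ := Sum.inr j) hRC)
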